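/- Let Σ be an FD set over {1,…,d}, let D ⊆ dom^d be a finite nonempty instance, and let w : D → ℝ≥0 be a weight function; write minrep(D, Σ) for the minimum of Σ_{t∈I} w(t) over all repairs I of D w.r.t. Σ. Then: (i) if some attribute A belongs to the left-hand side of every FD of Σ, then minrep(D, Σ) = Σ_{a ∈ π_A(D)} minrep(σ_{A=a}(D), Σ − A); and (ii) if Σ contains a consensus FD ∅ → {A}, then minrep(D, Σ) = min_{a ∈ π_A(D)} minrep(σ_{A=a}(D), Σ − A). -/

import Mathlib

/-- A set `I` of tuples satisfies the FD `fd = (X, B)` if any two tuples of `I`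
agreeing on every attribute of `X` also agree on every attribute of `B`. -/
def SatFD {d : ℕ} {dom : Type*} (I : Finset (Fin d → dom))
    (fd : Set (Fin d) × Set (Fin d)) : Prop :=
  ∀ s ∈ I, ∀ t ∈ I, (∀ a ∈ fd.1, s a = t a) → ∀ b ∈ fd.2, s b = t b

/-- `I` satisfies every FD of the FD set `FDs`. -/
def SatFDs {d : ℕ} {dom : Type*} (I : Finset (Fin d → dom))
    (FDs : Set (Set (Fin d) × Set (Fin d))) : Prop :=
  ∀ fd ∈ FDs, SatFD I fd

/-- `I` is a repair of `D` w.r.t. `FDs`: a subset of `D` satisfying `FDs` that is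
maximal under inclusion among the subsets of `D` satisfying `FDs`. -/
def IsFDRepair {d : ℕ} {dom : Type*} (FDs : Set (Set (Fin d) × Set (Fin d)))
    (D I : Finset (Fin d → dom)) : Prop :=
  I ⊆ D ∧ SatFDs I FDs ∧ ∀ J : Finset (Fin d → dom), I ⊆ J → J ⊆ D → SatFDs J FDs → J = I

/-- `FDs − A`: remove attribute `A` from the left- and right-hand side of every FD. -/
def removeAttr {d : ℕ} (A : Fin d) (FDs : Set (Set (Fin d) × Set (Fin d))) :
    Set (Set (Fin d) × Set (Fin d)) :=
  (fun fd => (fd.1 \ {A}, fd.2 \ {A})) '' FDs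

/-- `minrep D FDs w`: the minimum total weight `Σ_{t ∈ I} w t` over all repairs
`I` of `D` w.r.t. `FDs`. -/
noncomputable def minrep {d : ℕ} {dom : Type*} (FDs : Set (Set (Fin d) × Set (Fin d)))
    (w : (Fin d → dom) → NNReal) (D : Finset (Fin d → dom)) : NNReal :=
  sInf ((fun I : Finset (Fin d → dom) => ∑ t ∈ I, w t) '' {I | IsFDRepair FDs D I})

section Satisfaction

variable {d : ℕ} {dom : Type*} {FDs : Set (Set (Fin d) × Set (Fin d))}
  {D I J : Finset (Fin d → dom)} {A : Fin d} {a : dom}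

theorem SatFDs.mono (hIJ : I ⊆ J) (hJ : SatFDs J FDs) : SatFDs I FDs :=
  fun fd hfd s hs t ht => hJ fd hfd s (hIJ hs) t (hIJ ht)

theorem SatFDs.eq_of_consensus (hA : ((∅ : Set (Fin d)), ({A} : Set (Fin d))) ∈ FDs)
    (hI : SatFDs I FDs) {s t : Fin d → dom} (hs : s ∈ I) (ht : t ∈ I) : s A = t A :=
  hI _ hA s hs t ht (by simp) A rfl

/-- On an instance where `A` is constant, removing `A` from the FDs changes nothing. -/
theorem satFDs_removeAttr_iff (hI : ∀ s ∈ I, s A = a) :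
    SatFDs I (removeAttr A FDs) ↔ SatFDs I FDs := by
  constructor
  · intro h fd hfd s hs t ht hst b hb
    by_cases hbA : b = A
    · rw [hbA, hI s hs, hI t ht]
    · exact h _ ⟨fd, hfd, rfl⟩ s hs t ht (fun c hc => hst c hc.1) b ⟨hb, hbA⟩
  · rintro h _ ⟨fd, hfd, rfl⟩ s hs t ht hst b hb
    refine h fd hfd s hs t ht (fun c hc => ?_) b hb.1
    by_cases hcA : c = A
    · rw [hcA, hI s hs, hI t ht]
    · exact hst c ⟨hc, hcA⟩

theorem isFDRepair_removeAttr_iff (hD : ∀ s ∈ D, s A = a) :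
    IsFDRepair (removeAttr A FDs) D I ↔ IsFDRepair FDs D I := by
  have hsub : ∀ J ⊆ D, (SatFDs J (removeAttr A FDs) ↔ SatFDs J FDs) := fun J hJ =>
    satFDs_removeAttr_iff fun s hs => hD s (hJ hs)
  constructor
  · rintro ⟨h, hs, hm⟩
    exact ⟨h, (hsub I h).1 hs, fun J hIJ hJ hJs => hm J hIJ hJ ((hsub J hJ).2 hJs)⟩
  · rintro ⟨h, hs, hm⟩
    exact ⟨h, (hsub I h).2 hs, fun J hIJ hJ hJs => hm J hIJ hJ ((hsub J hJ).1 hJs)⟩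

theorem exists_isFDRepair (FDs : Set (Set (Fin d) × Set (Fin d)))
    (D : Finset (Fin d → dom)) : ∃ I, IsFDRepair FDs D I := by
  have hfin : {I : Finset (Fin d → dom) | I ⊆ D ∧ SatFDs I FDs}.Finite :=
    D.powerset.finite_toSet.subset fun I hI => by simpa using hI.1
  obtain ⟨I, hI⟩ := hfin.exists_maximal ⟨∅, by simp, fun _ _ _ hs => by simp at hs⟩
  exact ⟨I, hI.prop.1, hI.prop.2, fun J hIJ hJ hJs => hI.eq_of_ge ⟨hJ, hJs⟩ hIJ⟩

theorem IsFDRepair.nonempty (hD : D.Nonempty) (hI : IsFDRepair FDs D I) : I.Nonempty := by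
  obtain ⟨t, ht⟩ := hD
  by_contra hne
  rw [Finset.not_nonempty_iff_eq_empty] at hne
  subst hne
  refine Finset.singleton_ne_empty t (hI.2.2 {t} (by simp) (by simpa using ht) ?_)
  intro fd _ s hs u hu _ b _
  rw [Finset.mem_singleton.1 hs, Finset.mem_singleton.1 hu]

end Satisfaction

section Minrep

variable {d : ℕ} {dom : Type*} {FDs : Set (Set (Fin d) × Set (Fin d))}
  {D I : Finset (Fin d → dom)} {A : Fin d} {a : dom}

theorem minrep_removeAttr (w : (Fin d → dom) → NNReal) (hD : ∀ s ∈ D, s A = a) :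
    minrep (removeAttr A FDs) w D = minrep FDs w D := by
  simp only [minrep, isFDRepair_removeAttr_iff hD]

theorem minrep_le (w : (Fin d → dom) → NNReal) (hI : IsFDRepair FDs D I) :
    minrep FDs w D ≤ ∑ t ∈ I, w t :=
  csInf_le' ⟨I, hI, rfl⟩

theorem exists_sum_eq_minrep (FDs : Set (Set (Fin d) × Set (Fin d)))
    (w : (Fin d → dom) → NNReal) (D : Finset (Fin d → dom)) :
    ∃ I, IsFDRepair FDs D I ∧ ∑ t ∈ I, w t = minrep FDs w D := by
  have hfin : {I | IsFDRepair FDs D I}.Finite :=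
    D.powerset.finite_toSet.subset fun I hI => by simpa using hI.1
  have hne : {I | IsFDRepair FDs D I}.Nonempty := exists_isFDRepair FDs D
  exact (hne.image _).csInf_mem (hfin.image _)

end Minrep

section Selection

variable {d : ℕ} {dom : Type*} [DecidableEq dom] {FDs : Set (Set (Fin d) × Set (Fin d))}
  {D I : Finset (Fin d → dom)} {A : Fin d} {a : dom}

theorem IsFDRepair.filter (hA : ∀ fd ∈ FDs, A ∈ fd.1) (hI : IsFDRepair FDs D I) (a : dom) :
    IsFDRepair FDs (D.filter fun t => t A = a) (I.filter fun t => t A = a) := by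
  refine ⟨Finset.filter_subset_filter _ hI.1, hI.2.1.mono (Finset.filter_subset _ _), ?_⟩
  intro J hIJ hJ hJs
  have hJA : ∀ t ∈ J, t A = a := fun t ht => (Finset.mem_filter.1 (hJ ht)).2
  have hmem : ∀ t ∈ I ∪ J, t A = a → t ∈ J := fun t ht hta =>
    (Finset.mem_union.1 ht).elim (fun h => hIJ (Finset.mem_filter.2 ⟨h, hta⟩)) id
  have hunion : I ∪ J = I := by
    refine hI.2.2 _ Finset.subset_union_left
      (Finset.union_subset hI.1 (hJ.trans (Finset.filter_subset _ _))) ?_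
    intro fd hfd s hs t ht hst
    have hstA : s A = t A := hst A (hA fd hfd)
    by_cases hsa : s A = a
    · exact hJs fd hfd s (hmem s hs hsa) t (hmem t ht (hstA ▸ hsa)) hst
    · have hsI : s ∈ I := (Finset.mem_union.1 hs).resolve_right fun h => hsa (hJA s h)
      have htI : t ∈ I :=
        (Finset.mem_union.1 ht).resolve_right fun h => hsa (hstA.trans (hJA t h))
      exact hI.2.1 fd hfd s hsI t htI hst
  refine Finset.Subset.antisymm (fun t ht => Finset.mem_filter.2 ⟨?_, hJA t ht⟩) hIJ
  exact hunion ▸ Finset.mem_union_right I ht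

theorem isFDRepair_biUnion (hA : ∀ fd ∈ FDs, A ∈ fd.1) {F : dom → Finset (Fin d → dom)}
    (hF : ∀ a, IsFDRepair FDs (D.filter fun t => t A = a) (F a)) :
    IsFDRepair FDs D ((D.image fun t => t A).biUnion F) := by
  have hFD : ∀ a, ∀ t ∈ F a, t ∈ D ∧ t A = a := fun a t ht =>
    Finset.mem_filter.1 ((hF a).1 ht)
  refine ⟨?_, ?_, ?_⟩
  · intro t ht
    obtain ⟨a, -, hta⟩ := Finset.mem_biUnion.1 ht
    exact (hFD a t hta).1
  · intro fd hfd s hs t ht hst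
    obtain ⟨a, -, hsa⟩ := Finset.mem_biUnion.1 hs
    obtain ⟨b, -, htb⟩ := Finset.mem_biUnion.1 ht
    have hab : b = a := by
      rw [← (hFD a s hsa).2, ← (hFD b t htb).2, hst A (hA fd hfd)]
    subst hab
    exact (hF b).2.1 fd hfd s hsa t htb hst
  · intro J hIJ hJ hJs
    refine Finset.Subset.antisymm (fun s hs => ?_) hIJ
    have hsA : s A ∈ D.image fun t => t A := Finset.mem_image_of_mem _ (hJ hs)
    have hfilter : J.filter (fun t => t A = s A) = F (s A) := by
      refine (hF (s A)).2.2 _ (fun t ht => ?_) (Finset.filter_subset_filter _ hJ)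
        (hJs.mono (Finset.filter_subset _ _))
      exact Finset.mem_filter.2 ⟨hIJ (Finset.mem_biUnion.2 ⟨s A, hsA, ht⟩), (hFD _ t ht).2⟩
    exact Finset.mem_biUnion.2 ⟨s A, hsA, hfilter ▸ Finset.mem_filter.2 ⟨hs, rfl⟩⟩

theorem isFDRepair_of_isFDRepair_filter
    (hA : ((∅ : Set (Fin d)), ({A} : Set (Fin d))) ∈ FDs)
    (ha : a ∈ D.image fun t => t A) (hI : IsFDRepair FDs (D.filter fun t => t A = a) I) :
    IsFDRepair FDs D I := by
  obtain ⟨u, hu, hua⟩ := Finset.mem_image.1 ha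
  obtain ⟨t, ht⟩ := hI.nonempty ⟨u, Finset.mem_filter.2 ⟨hu, hua⟩⟩
  refine ⟨hI.1.trans (Finset.filter_subset _ _), hI.2.1, fun J hIJ hJ hJs => ?_⟩
  refine hI.2.2 J hIJ (fun s hs => Finset.mem_filter.2 ⟨hJ hs, ?_⟩) hJs
  exact (hJs.eq_of_consensus hA hs (hIJ ht)).trans (Finset.mem_filter.1 (hI.1 ht)).2

theorem IsFDRepair.exists_isFDRepair_filter
    (hA : ((∅ : Set (Fin d)), ({A} : Set (Fin d))) ∈ FDs)
    (hD : D.Nonempty) (hI : IsFDRepair FDs D I) :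
    ∃ a ∈ D.image fun t => t A, IsFDRepair FDs (D.filter fun t => t A = a) I := by
  obtain ⟨t, ht⟩ := hI.nonempty hD
  refine ⟨t A, Finset.mem_image_of_mem _ (hI.1 ht), fun s hs => ?_, hI.2.1, ?_⟩
  · exact Finset.mem_filter.2 ⟨hI.1 hs, hI.2.1.eq_of_consensus hA hs ht⟩
  · exact fun J hIJ hJ hJs => hI.2.2 J hIJ (hJ.trans (Finset.filter_subset _ _)) hJs

theorem minrep_eq_sum (hA : ∀ fd ∈ FDs, A ∈ fd.1) (w : (Fin d → dom) → NNReal) :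
    minrep FDs w D =
      ∑ a ∈ D.image (fun t => t A), minrep FDs w (D.filter fun t => t A = a) := by
  apply le_antisymm
  · choose F hF hFw using fun a => exists_sum_eq_minrep FDs w (D.filter fun t => t A = a)
    refine (minrep_le w (isFDRepair_biUnion hA hF)).trans_eq ?_
    rw [Finset.sum_biUnion]
    · exact Finset.sum_congr rfl fun a _ => hFw a
    · intro a _ b _ hab
      refine Finset.disjoint_left.2 fun t hta htb => hab ?_
      rw [← (Finset.mem_filter.1 ((hF a).1 hta)).2, (Finset.mem_filter.1 ((hF b).1 htb)).2]
  · obtain ⟨I, hI, hIw⟩ := exists_sum_eq_minrep FDs w D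
    rw [← hIw, ← Finset.sum_fiberwise_of_maps_to
      (fun t ht => Finset.mem_image_of_mem (fun t => t A) (hI.1 ht))]
    exact Finset.sum_le_sum fun a _ => minrep_le w (hI.filter hA a)

theorem minrep_eq_inf' (hA : ((∅ : Set (Fin d)), ({A} : Set (Fin d))) ∈ FDs)
    (hD : D.Nonempty) (w : (Fin d → dom) → NNReal) :
    minrep FDs w D =
      (D.image fun t => t A).inf' (hD.image _)
        (fun a => minrep FDs w (D.filter fun t => t A = a)) := by
  apply le_antisymm
  · refine Finset.le_inf' _ _ fun a ha => ?_
    obtain ⟨I, hI, hIw⟩ := exists_sum_eq_minrep FDs w (D.filter fun t => t A = a)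
    exact (minrep_le w (isFDRepair_of_isFDRepair_filter hA ha hI)).trans_eq hIw
  · obtain ⟨I, hI, hIw⟩ := exists_sum_eq_minrep FDs w D
    obtain ⟨a, ha, hIa⟩ := hI.exists_isFDRepair_filter hA hD
    exact (Finset.inf'_le _ ha).trans ((minrep_le w hIa).trans_eq hIw)

end Selection

theorem stmt14 {d : ℕ} {dom : Type*} [DecidableEq dom]
    (FDs : Set (Set (Fin d) × Set (Fin d)))
    (D : Finset (Fin d → dom)) (hD : D.Nonempty)
    (w : (Fin d → dom) → NNReal) :
    -- (i) if some attribute A belongs to the lhs of every FD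
    (∀ A : Fin d, (∀ fd ∈ FDs, A ∈ fd.1) →
      minrep FDs w D =
        ∑ a ∈ D.image (fun t => t A),
          minrep (removeAttr A FDs) w (D.filter (fun t => t A = a))) ∧
    -- (ii) if FDs contains a consensus FD ∅ → {A}
    (∀ A : Fin d, ((∅ : Set (Fin d)), ({A} : Set (Fin d))) ∈ FDs →
      minrep FDs w D =
        (D.image (fun t => t A)).inf' (hD.image _)
          (fun a => minrep (removeAttr A FDs) w (D.filter (fun t => t A = a)))) := by
  have hconst : ∀ (A : Fin d) (a : dom), ∀ s ∈ D.filter (fun t => t A = a), s A = a :=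
    fun A a s hs => (Finset.mem_filter.1 hs).2
  refine ⟨fun A hA => ?_, fun A hA => ?_⟩
  · simp only [minrep_removeAttr w (hconst A _)]
    exact minrep_eq_sum hA w
  · simp only [minrep_removeAttr w (hconst A _)]
    exact minrep_eq_inf' hA hD w
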